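/- arXiv:1608.06308 — 3 statements merged into one kernel-verified Lean document; each statement's English description precedes it below -/
import Mathlib

section
/- Uniform integral bound with quadratic phase: For every b>1/2 there is a constant c=c(b)>0 such that ∫_{−∞}^{+∞} dx/⟨α₀+α₁x+x²⟩^{b} ≤ c for all α₀,α₁∈ℝ. -/
open MeasureTheory

/-- Uniform integral bound with quadratic phase: for every `b > 1/2` there is a constant
`c = c(b) > 0` such that `∫ dx / ⟨α₀ + α₁ x + x²⟩^b ≤ c` for all `α₀, α₁ ∈ ℝ`,
where `⟨y⟩ = 1 + |y|`. -/
theorem quadratic_phase_integral_bound (b : ℝ) (hb : 1 / 2 < b) :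
    ∃ c > (0 : ℝ), ∀ α₀ α₁ : ℝ,
      (∫ x : ℝ, ((1 + |α₀ + α₁ * x + x ^ 2|) ^ b)⁻¹) ≤ c := by
  have hg : Integrable (fun t : ℝ => ((1 + t ^ 2) ^ b)⁻¹) := by
    have h := integrable_rpow_neg_one_add_norm_sq (E := ℝ) (μ := volume) (r := 2 * b)
      (by simp; linarith)
    refine h.congr (Filter.Eventually.of_forall fun t => ?_)
    have e : -(2 * b) / 2 = -b := by ring
    simp only [e, Real.norm_eq_abs, sq_abs]
    exact Real.rpow_neg (by positivity) b
  have hI : 0 ≤ ∫ t : ℝ, ((1 + t ^ 2) ^ b)⁻¹ := integral_nonneg fun t => by positivity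
  refine ⟨2 * (∫ t : ℝ, ((1 + t ^ 2) ^ b)⁻¹) + 1, by linarith, fun α₀ α₁ => ?_⟩
  obtain ⟨m, hm0, hm⟩ : ∃ m : ℝ, 0 ≤ m ∧ ∀ y : ℝ,
      (y - m) ^ 2 ≤ |α₀ - α₁ ^ 2 / 4 + y ^ 2| ∨ (y + m) ^ 2 ≤ |α₀ - α₁ ^ 2 / 4 + y ^ 2| := by
    generalize α₀ - α₁ ^ 2 / 4 = A
    rcases le_total 0 A with hA | hA
    · refine ⟨0, le_rfl, fun y => Or.inl ?_⟩
      have := le_abs_self (A + y ^ 2)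
      nlinarith
    · refine ⟨√(-A), Real.sqrt_nonneg _, fun y => ?_⟩
      have hs := Real.sq_sqrt (neg_nonneg.2 hA)
      have h0 := Real.sqrt_nonneg (-A)
      generalize √(-A) = m at *
      have hA' : A = -m ^ 2 := by linarith
      subst hA'
      have h1 := le_abs_self (-m ^ 2 + y ^ 2)
      have h2 := neg_abs_le (-m ^ 2 + y ^ 2)
      rcases le_total 0 y with hy | hy
      · left
        rcases le_total m y with h | h <;> nlinarith [mul_nonneg h0 (sub_nonneg.2 h), mul_nonneg hy (sub_nonneg.2 h)]
      · right
        rcases le_total m (-y) with h | h <;> nlinarith [mul_nonneg h0 (sub_nonneg.2 h), mul_nonneg (neg_nonneg.2 hy) (sub_nonneg.2 h)]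
  have h1 := hg.comp_add_right (α₁ / 2 - m)
  have h2 := hg.comp_add_right (α₁ / 2 + m)
  have key : ∀ y z : ℝ, y ^ 2 ≤ |z| → ((1 + |z|) ^ b)⁻¹ ≤ ((1 + y ^ 2) ^ b)⁻¹ := by
    intro y z h
    apply inv_anti₀ (by positivity)
    exact Real.rpow_le_rpow (by positivity) (by linarith) (by linarith)
  have hle := integral_mono_of_nonneg (μ := volume)
    (f := fun x : ℝ => ((1 + |α₀ + α₁ * x + x ^ 2|) ^ b)⁻¹)
    (Filter.Eventually.of_forall fun x => by positivity) (h1.add h2)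
    (Filter.Eventually.of_forall fun x => by
      have e : α₀ - α₁ ^ 2 / 4 + (x + α₁ / 2) ^ 2 = α₀ + α₁ * x + x ^ 2 := by ring
      have p1 : 0 ≤ ((1 + (x + (α₁ / 2 - m)) ^ 2) ^ b)⁻¹ := by positivity
      have p2 : 0 ≤ ((1 + (x + (α₁ / 2 + m)) ^ 2) ^ b)⁻¹ := by positivity
      simp only [Pi.add_apply]
      have := hm (x + α₁ / 2)
      rw [e, add_sub_assoc, add_assoc x] at this
      rcases this with h | h
      · have := key _ _ h
        linarith
      · have := key _ _ h
        linarith)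
  rw [integral_add' h1 h2, integral_add_right_eq_self (fun t : ℝ => ((1 + t ^ 2) ^ b)⁻¹),
    integral_add_right_eq_self (fun t : ℝ => ((1 + t ^ 2) ^ b)⁻¹)] at hle
  linarith
end

section
/- Uniform integral bound with cubic phase: For every b>1/3 there is a constant c=c(b)>0 such that ∫_{−∞}^{+∞} dx/⟨α₀+α₁x+α₂x²+x³⟩^{b} ≤ c for all α₀,α₁,α₂∈ℝ. -/
open MeasureTheory

theorem cubic_factor (α₀ α₁ α₂ : ℝ) : ∃ u v w : ℝ, ∀ x : ℝ,
    |x - u| * |x - v| * |x - w| ≤ |α₀ + α₁ * x + α₂ * x ^ 2 + x ^ 3| := by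
  let P : Cubic ℂ := ⟨1, α₂, α₁, α₀⟩
  have ha : P.a ≠ 0 := one_ne_zero
  have hs : (P.toPoly.map (RingHom.id ℂ)).Splits := IsAlgClosed.splits _
  obtain ⟨x, y, z, h3⟩ := (Cubic.splits_iff_roots_eq_three (φ := RingHom.id ℂ) ha).1 hs
  have hb := Cubic.b_eq_three_roots ha h3
  have hc := Cubic.c_eq_three_roots ha h3
  have hd := Cubic.d_eq_three_roots ha h3
  simp only [RingHom.id_apply, P] at hb hc hd
  refine ⟨x.re, y.re, z.re, fun t => ?_⟩
  have key : ((α₀ + α₁ * t + α₂ * t ^ 2 + t ^ 3 : ℝ) : ℂ) = (t - x) * (t - y) * (t - z) := by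
    push_cast
    rw [hb, hc, hd]; ring
  have hn : |α₀ + α₁ * t + α₂ * t ^ 2 + t ^ 3| = ‖(t - x : ℂ)‖ * ‖(t - y : ℂ)‖ * ‖(t - z : ℂ)‖ := by
    rw [← norm_mul, ← norm_mul, ← key, Complex.norm_real, Real.norm_eq_abs]
  have hr : ∀ w : ℂ, |t - w.re| ≤ ‖(t - w : ℂ)‖ := fun w => by
    simpa using Complex.abs_re_le_norm (t - w : ℂ)
  rw [hn]
  gcongr <;> exact hr _

theorem term_bound (b : ℝ) (hb : 1 / 3 < b) (s A : ℝ) (hs : 0 ≤ s) (h : s ^ 3 ≤ A) :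
    ((1 + A) ^ b)⁻¹ ≤ 4 ^ b * (1 + s) ^ (-(3 * b)) := by
  have h1 : (1 + s) ^ 3 / 4 ≤ 1 + A := by
    nlinarith [mul_nonneg (by positivity : 0 ≤ 1 + s) (sq_nonneg (1 - s))]
  have h0 : 0 < (1 + s) ^ 3 / 4 := by positivity
  calc ((1 + A) ^ b)⁻¹ ≤ (((1 + s) ^ 3 / 4) ^ b)⁻¹ := by gcongr
    _ = 4 ^ b * (1 + s) ^ (-(3 * b)) := by
      rw [Real.div_rpow (by positivity) (by norm_num), Real.rpow_neg (by positivity),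
        Real.rpow_mul (by positivity)]
      norm_num [div_eq_mul_inv]

/-- Uniform integral bound with cubic phase: for every `b > 1/3` there is a constant
`c = c(b) > 0` such that `∫ dx / ⟨α₀ + α₁ x + α₂ x² + x³⟩^b ≤ c` for all `α₀, α₁, α₂ ∈ ℝ`,
where `⟨y⟩ = 1 + |y|`. -/
theorem cubic_phase_integral_bound (b : ℝ) (hb : 1 / 3 < b) :
    ∃ c > (0 : ℝ), ∀ α₀ α₁ α₂ : ℝ,
      (∫ x : ℝ, ((1 + |α₀ + α₁ * x + α₂ * x ^ 2 + x ^ 3|) ^ b)⁻¹) ≤ c := by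
  let g : ℝ → ℝ := fun x => 4 ^ b * (1 + |x|) ^ (-(3 * b))
  have hg : Integrable g := by
    have := integrable_one_add_norm (E := ℝ) (μ := volume) (r := 3 * b)
      (by simp; linarith)
    exact this.const_mul _
  have g0 : ∀ x, 0 ≤ g x := fun x => by positivity
  have hI : 0 ≤ ∫ x, g x := integral_nonneg g0
  refine ⟨3 * (∫ x, g x) + 1, by linarith, fun α₀ α₁ α₂ => ?_⟩
  obtain ⟨u, v, w, h⟩ := cubic_factor α₀ α₁ α₂
  have hi : ∀ u, Integrable (fun x => g (x - u)) := fun u => hg.comp_sub_right u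
  have he : ∫ x, (g (x - u) + g (x - v) + g (x - w)) = 3 * ∫ x, g x := by
    have huv : Integrable (fun x => g (x - u) + g (x - v)) := (hi u).add (hi v)
    rw [integral_add huv (hi w), integral_add (hi u) (hi v),
      integral_sub_right_eq_self g, integral_sub_right_eq_self g, integral_sub_right_eq_self g]
    ring
  have hle : (∫ x : ℝ, ((1 + |α₀ + α₁ * x + α₂ * x ^ 2 + x ^ 3|) ^ b)⁻¹) ≤
      ∫ x, (g (x - u) + g (x - v) + g (x - w)) := by
    refine integral_mono_of_nonneg (Filter.Eventually.of_forall fun x => by positivity)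
      (((hi u).add (hi v)).add (hi w)) (Filter.Eventually.of_forall fun x => ?_)
    have hx := h x
    have a1 := g0 (x - u)
    have a2 := g0 (x - v)
    have a3 := g0 (x - w)
    have main : ∀ s : ℝ, |s| ≤ |x - u| → |s| ≤ |x - v| → |s| ≤ |x - w| →
        ((1 + |α₀ + α₁ * x + α₂ * x ^ 2 + x ^ 3|) ^ b)⁻¹ ≤ g s := fun s h1 h2 h3 => by
      refine term_bound b hb |s| _ (abs_nonneg s) (le_trans ?_ hx)
      calc |s| ^ 3 = |s| * |s| * |s| := by ring
        _ ≤ _ := by gcongr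
    show ((1 + |α₀ + α₁ * x + α₂ * x ^ 2 + x ^ 3|) ^ b)⁻¹ ≤ g (x - u) + g (x - v) + g (x - w)
    rcases le_total |x - u| |x - v| with h1 | h1 <;>
    rcases le_total |x - u| |x - w| with h2 | h2 <;>
    rcases le_total |x - v| |x - w| with h3 | h3
    · linarith [main _ le_rfl h1 h2]
    · linarith [main _ le_rfl h1 h2]
    · linarith [main _ h2 (h2.trans h1) le_rfl]
    · linarith [main _ h2 h3 le_rfl]
    · linarith [main _ h1 le_rfl h3]
    · linarith [main _ (h3.trans h1) h3 le_rfl]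
    · linarith [main _ h1 le_rfl h3]
    · linarith [main _ h2 h3 le_rfl]
  linarith
end

section
/- Truncated singular-weight integral estimate: For every b<1/2 there is a constant c=c(b)>0 such that for all α∈ℝ and all β>0, ∫_{|x|<β} dx/(⟨x⟩^{4b−1}|α−x|^{1/2}) ≤ c (1+β)^{2−4b}/⟨α⟩^{1/2}. -/
open MeasureTheory

lemma tsi_sym (f : ℝ → ℝ) (r : ℝ) (hr : 0 ≤ r) (hf : IntervalIntegrable f volume 0 r) :
    IntervalIntegrable (fun x => f |x|) volume (-r) r ∧
      ∫ x in (-r)..r, f |x| = 2 * ∫ x in (0 : ℝ)..r, f x := by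
  have h1 : IntervalIntegrable (fun x => f |x|) volume 0 r := by
    refine hf.congr ?_
    intro x hx
    rw [Set.uIoc_of_le hr] at hx
    simp [abs_of_pos hx.1]
  have h2 : IntervalIntegrable (fun x => f |x|) volume (-r) 0 := by
    have := (IntervalIntegrable.iff_comp_neg (f := fun x => f |x|)).1 h1
    simp only [abs_neg, neg_zero] at this
    exact this.symm
  refine ⟨h2.trans h1, ?_⟩
  rw [← intervalIntegral.integral_add_adjacent_intervals h2 h1]
  have e1 : ∫ x in (0 : ℝ)..r, f |x| = ∫ x in (0 : ℝ)..r, f x := by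
    apply intervalIntegral.integral_congr
    intro x hx
    rw [Set.uIcc_of_le hr] at hx
    simp [abs_of_nonneg hx.1]
  have e2 : ∫ x in (-r)..0, f |x| = ∫ x in (0 : ℝ)..r, f |x| := by
    have := intervalIntegral.integral_comp_neg (a := 0) (b := r) (fun x => f |x|)
    simp only [abs_neg, neg_zero] at this
    exact this.symm
  rw [e2, e1]; ring

lemma tsi_weight (p β : ℝ) (hp : p < 1) (hβ : 0 < β) :
    IntegrableOn (fun x : ℝ => (1 + |x|) ^ (-p)) (Set.Ioo (-β) β) ∧
      ∫ x in Set.Ioo (-β) β, (1 + |x|) ^ (-p) ≤ 2 / (1 - p) * (1 + β) ^ (1 - p) := by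
  have hi : IntervalIntegrable (fun x : ℝ => x ^ (-p)) volume 1 (1 + β) :=
    intervalIntegral.intervalIntegrable_rpow (by
      right; rw [Set.uIcc_of_le (by linarith)]; intro h; linarith [h.1])
  have hi' : IntervalIntegrable (fun x : ℝ => (1 + x) ^ (-p)) volume 0 β := by
    have := hi.comp_add_left 1
    simpa using this
  obtain ⟨h1, h2⟩ := tsi_sym (fun x => (1 + x) ^ (-p)) β hβ.le hi'
  have hle : -β ≤ β := by linarith
  refine ⟨(intervalIntegrable_iff_integrableOn_Ioo_of_le hle).1 h1, ?_⟩
  rw [← integral_Ioc_eq_integral_Ioo, ← intervalIntegral.integral_of_le hle, h2]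
  rw [intervalIntegral.integral_comp_add_left (fun x : ℝ => x ^ (-p)) 1]
  rw [integral_rpow (by
    right; refine ⟨by intro h; linarith, ?_⟩
    rw [Set.uIcc_of_le (by linarith)]; intro h; linarith [h.1])]
  have e : -p + 1 = 1 - p := by ring
  rw [e]
  have : 0 < 1 - p := by linarith
  simp only [add_zero, Real.one_rpow]
  rw [← mul_div_assoc, div_mul_eq_mul_div]
  gcongr
  linarith

lemma tsi_sing (r : ℝ) (hr : 0 < r) :
    IntegrableOn (fun x : ℝ => |x| ^ (-(1 / 2) : ℝ)) (Set.Ioo (-r) r) ∧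
      ∫ x in Set.Ioo (-r) r, |x| ^ (-(1 / 2) : ℝ) = 4 * r ^ (1 / 2 : ℝ) := by
  have hi : IntervalIntegrable (fun x : ℝ => x ^ (-(1 / 2) : ℝ)) volume 0 r :=
    intervalIntegral.intervalIntegrable_rpow' (by norm_num)
  obtain ⟨h1, h2⟩ := tsi_sym (fun x => x ^ (-(1 / 2) : ℝ)) r hr.le hi
  have hle : -r ≤ r := by linarith
  refine ⟨(intervalIntegrable_iff_integrableOn_Ioo_of_le hle).1 h1, ?_⟩
  rw [← integral_Ioc_eq_integral_Ioo, ← intervalIntegral.integral_of_le hle, h2]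
  rw [integral_rpow (by left; norm_num)]
  have e : (-(1 / 2) + 1 : ℝ) = 1 / 2 := by norm_num
  rw [e, Real.zero_rpow (by norm_num)]
  ring

lemma tsi_pt (p α β x : ℝ) (hp : p < 1) (hx : x ∈ Set.Ioo (-β) β) :
    ((1 + |x|) ^ p * |α - x| ^ ((1 : ℝ) / 2))⁻¹ ≤
      2 / (1 + |α|) ^ ((1 : ℝ) / 2) * (1 + |x|) ^ (-p) +
      2 * (1 + β) ^ (1 - p) / (1 + |α|) *
        (Set.Ioo (-((1 + |α|) / 2)) ((1 + |α|) / 2)).indicator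
          (fun x : ℝ => |x| ^ (-(1 / 2) : ℝ)) (x - α) := by
  have hA : 0 < 1 + |α| := by positivity
  have hX : 0 < 1 + |x| := by positivity
  have hxb : |x| < β := abs_lt.2 hx
  have hB : 0 < 1 + β := by linarith [abs_nonneg x]
  have hinv : ((1 + |x|) ^ p * |α - x| ^ ((1 : ℝ) / 2))⁻¹
      = (1 + |x|) ^ (-p) * |x - α| ^ (-(1 / 2) : ℝ) := by
    rw [mul_inv, Real.rpow_neg hX.le, Real.rpow_neg (abs_nonneg _), abs_sub_comm]
  rw [hinv]
  by_cases h : |x - α| < (1 + |α|) / 2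
  · rw [Set.indicator_of_mem (show x - α ∈ Set.Ioo (-((1 + |α|) / 2)) ((1 + |α|) / 2) from abs_lt.1 h)]
    have h1 : (1 + |α|) / 2 ≤ 1 + |x| := by
      have := abs_sub_abs_le_abs_sub α x
      rw [abs_sub_comm] at this
      linarith [abs_nonneg x]
    have h2 : (1 + |x|) ^ (-p) ≤ 2 * (1 + β) ^ (1 - p) / (1 + |α|) := by
      have e : (1 + |x|) ^ (-p) = (1 + |x|) ^ (1 - p) / (1 + |x|) := by
        rw [show -p = (1 - p) - 1 by ring, Real.rpow_sub_one hX.ne']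
      have h3 : (1 + |x|) ^ (1 - p) ≤ (1 + β) ^ (1 - p) :=
        Real.rpow_le_rpow hX.le (by linarith) (by linarith)
      rw [e]
      calc (1 + |x|) ^ (1 - p) / (1 + |x|) ≤ (1 + β) ^ (1 - p) / ((1 + |α|) / 2) := by
            gcongr
        _ = _ := by field_simp
    have h4 : 0 ≤ 2 / (1 + |α|) ^ ((1 : ℝ) / 2) * (1 + |x|) ^ (-p) := by positivity
    have h5 := mul_le_mul_of_nonneg_right h2
      (show 0 ≤ |x - α| ^ (-(1 / 2) : ℝ) by positivity)
    linarith
  · rw [Set.indicator_of_notMem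
      (show x - α ∉ Set.Ioo (-((1 + |α|) / 2)) ((1 + |α|) / 2) from fun h' => h (abs_lt.2 h'))]
    push Not at h
    rw [mul_zero, add_zero, mul_comm]
    have h1 : |x - α| ^ (-(1 / 2) : ℝ) ≤ ((1 + |α|) / 2) ^ (-(1 / 2) : ℝ) :=
      Real.rpow_le_rpow_of_nonpos (by positivity) h (by norm_num)
    have h2 : ((1 + |α|) / 2) ^ (-(1 / 2) : ℝ) ≤ 2 / (1 + |α|) ^ ((1 : ℝ) / 2) := by
      rw [Real.rpow_neg (by positivity), Real.div_rpow hA.le (by norm_num), inv_div]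
      gcongr
      calc (2 : ℝ) ^ (1 / 2 : ℝ) ≤ 2 ^ (1 : ℝ) :=
            Real.rpow_le_rpow_of_exponent_le (by norm_num) (by norm_num)
        _ = 2 := by simp
    gcongr
    exact h1.trans h2

/-- Truncated singular-weight integral estimate: for every `b < 1/2` there is `c = c(b) > 0`
such that for all `α ∈ ℝ` and `β > 0`,
`∫_{|x|<β} dx / (⟨x⟩^{4b-1} |α-x|^{1/2}) ≤ c (1+β)^{2-4b} / ⟨α⟩^{1/2}`, where `⟨y⟩ = 1+|y|`. -/
theorem truncated_singular_integral (b : ℝ) (hb : b < 1 / 2) :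
    ∃ c > (0 : ℝ), ∀ α β : ℝ, 0 < β →
      (∫ x in Set.Ioo (-β) β, ((1 + |x|) ^ (4 * b - 1) * |α - x| ^ ((1 : ℝ) / 2))⁻¹)
        ≤ c * (1 + β) ^ (2 - 4 * b) / (1 + |α|) ^ ((1 : ℝ) / 2) := by
  obtain ⟨p, hpb⟩ : ∃ p, p = 4 * b - 1 := ⟨_, rfl⟩
  have hp : p < 1 := by linarith
  have hp' : 0 < 1 - p := by linarith
  rw [← hpb, show 2 - 4 * b = 1 - p by rw [hpb]; ring]
  refine ⟨4 / (1 - p) + 8, by positivity, ?_⟩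
  intro α β hβ
  have hA : 0 < 1 + |α| := by positivity
  obtain ⟨w1, w2⟩ := tsi_weight p β hp hβ
  obtain ⟨s1, s2⟩ := tsi_sing ((1 + |α|) / 2) (by positivity)
  set H : ℝ → ℝ := (Set.Ioo (-((1 + |α|) / 2)) ((1 + |α|) / 2)).indicator
          (fun x : ℝ => |x| ^ (-(1 / 2) : ℝ)) with hH
  have hHi : Integrable H := s1.integrable_indicator measurableSet_Ioo
  have hHi' : Integrable (fun x => H (x - α)) := hHi.comp_sub_right α
  have hH0 : ∀ x, 0 ≤ H x := fun x => Set.indicator_nonneg (fun y _ => by positivity) x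
  have hHint : ∫ x in Set.Ioo (-β) β, H (x - α) ≤ 4 * (1 + |α|) ^ (1 / 2 : ℝ) := by
    calc ∫ x in Set.Ioo (-β) β, H (x - α) ≤ ∫ x, H (x - α) :=
          setIntegral_le_integral hHi' (Filter.Eventually.of_forall fun x => hH0 _)
      _ = ∫ x, H x := integral_sub_right_eq_self H α
      _ = 4 * ((1 + |α|) / 2) ^ (1 / 2 : ℝ) := by
          rw [hH, integral_indicator measurableSet_Ioo, s2]
      _ ≤ _ := by gcongr; linarith
  have hI1 : Integrable (fun x : ℝ => 2 / (1 + |α|) ^ ((1 : ℝ) / 2) * (1 + |x|) ^ (-p))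
      (volume.restrict (Set.Ioo (-β) β)) := Integrable.const_mul w1 _
  have hI2 : Integrable (fun x : ℝ => 2 * (1 + β) ^ (1 - p) / (1 + |α|) * H (x - α))
      (volume.restrict (Set.Ioo (-β) β)) := (hHi'.restrict).const_mul _
  calc _ ≤ ∫ x in Set.Ioo (-β) β, (2 / (1 + |α|) ^ ((1 : ℝ) / 2) * (1 + |x|) ^ (-p) +
      2 * (1 + β) ^ (1 - p) / (1 + |α|) * H (x - α)) := by
        apply integral_mono_of_nonneg
        · exact Filter.Eventually.of_forall fun x => by
            simp only [Pi.zero_apply]; positivity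
        · exact hI1.add hI2
        · refine (ae_restrict_iff' measurableSet_Ioo).2 (Filter.Eventually.of_forall ?_)
          intro x hx
          exact tsi_pt p α β x hp hx
    _ = 2 / (1 + |α|) ^ ((1 : ℝ) / 2) * (∫ x in Set.Ioo (-β) β, (1 + |x|) ^ (-p)) +
      2 * (1 + β) ^ (1 - p) / (1 + |α|) * ∫ x in Set.Ioo (-β) β, H (x - α) := by
        rw [integral_add hI1 hI2, integral_const_mul, integral_const_mul]
    _ ≤ 2 / (1 + |α|) ^ ((1 : ℝ) / 2) * (2 / (1 - p) * (1 + β) ^ (1 - p)) +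
      2 * (1 + β) ^ (1 - p) / (1 + |α|) * (4 * (1 + |α|) ^ (1 / 2 : ℝ)) := by
        gcongr
    _ = _ := by
        have hs : (1 + |α|) = (1 + |α|) ^ (1 / 2 : ℝ) * (1 + |α|) ^ (1 / 2 : ℝ) := by
          rw [← Real.rpow_add hA]; norm_num
        have hs0 : 0 < (1 + |α|) ^ (1 / 2 : ℝ) := by positivity
        generalize (1 + |α|) ^ (1 / 2 : ℝ) = s at *
        rw [hs]
        field_simp
        ring
end
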